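/- arXiv:2412.11879 — 2 statements merged into one kernel-verified Lean document; each statement's English description precedes it below -/
import Mathlib

section
/- There exists a function F : ℂ → ℂ, meromorphic on all of ℂ, such that F(s) = ∫_0^1 ζ(1−s, x) · ζ(1−s, 1−x)² dx for every s with Re(s) > 1, and such that for every positive integer m: lim_{s→−m} (s+m)·F(s) = Σ_{j=0}^{m} C(m+j, j)·C(2m−j, m−j)·ζ(1+m+j)·ζ(1+2m−j)·(1 + 2·(−1)^j) + (1/2)·C(3m+1, 2m+1)·ζ(3m+2), where ζ(w) denotes the Riemann zeta function at the integer w and C(a,b) denotes the binomial coefficient. -/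
open Complex MeasureTheory HurwitzZeta Filter

/-- The entire function `(z - 1) ζ(z)`. -/
noncomputable def zetaEntire : ℂ → ℂ :=
  Function.update (fun z => (z - 1) * riemannZeta z) 1 1

lemma zetaEntire_of_ne {z : ℂ} (hz : z ≠ 1) : zetaEntire z = (z - 1) * riemannZeta z := by
  simp [zetaEntire, hz]

lemma differentiable_zetaEntire : Differentiable ℂ zetaEntire := by
  have hoff : ∀ z : ℂ, z ≠ 1 → DifferentiableAt ℂ zetaEntire z := by
    intro z hz
    have h : DifferentiableAt ℂ (fun z => (z - 1) * riemannZeta z) z :=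
      (differentiableAt_id.sub_const 1).mul (differentiableAt_riemannZeta hz)
    refine h.congr_of_eventuallyEq ?_
    filter_upwards [isOpen_ne.mem_nhds hz] with y hy using zetaEntire_of_ne hy
  intro z
  rcases eq_or_ne z 1 with rfl | hz
  · refine (analyticAt_of_differentiable_on_punctured_nhds_of_continuousAt ?_ ?_).differentiableAt
    · filter_upwards [self_mem_nhdsWithin] with y hy using hoff y hy
    · exact continuousAt_update_same.mpr riemannZeta_residue_one
  · exact hoff z hz

lemma exists_norm_zetaEntire_le :
    ∃ C : ℝ, 0 ≤ C ∧ ∀ z : ℂ, 2 ≤ z.re → ‖zetaEntire z‖ ≤ C * ‖z - 1‖ := by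
  have hs : Summable fun n : ℕ => 1 / ((n : ℝ) + 1) ^ 2 := by
    simpa using (summable_nat_add_iff 1).mpr (Real.summable_one_div_nat_pow.mpr one_lt_two)
  refine ⟨∑' n : ℕ, 1 / ((n : ℝ) + 1) ^ 2, tsum_nonneg fun n => by positivity, fun z hz => ?_⟩
  have h1 : z ≠ 1 := by rintro rfl; norm_num at hz
  rw [zetaEntire_of_ne h1, norm_mul, mul_comm,
    zeta_eq_tsum_one_div_nat_add_one_cpow (by linarith)]
  refine mul_le_mul_of_nonneg_right (tsum_of_norm_bounded hs.hasSum fun n => ?_) (norm_nonneg _)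
  have hn : (0 : ℝ) < (n : ℝ) + 1 := by positivity
  have hc : ((n : ℂ) + 1) = (((n : ℝ) + 1 : ℝ) : ℂ) := by push_cast; rfl
  rw [norm_div, norm_one, hc, norm_cpow_eq_rpow_re_of_pos hn]
  refine one_div_le_one_div_of_le (by positivity) ?_
  rw [← Real.rpow_natCast]
  exact Real.rpow_le_rpow_of_exponent_le (by linarith [Nat.cast_nonneg (α := ℝ) n])
    (by exact_mod_cast hz)

/-- The normalised rising factorial `z (z + 1) ⋯ (z + k - 1) / k!`. -/
noncomputable def risingCoeff (z : ℂ) (k : ℕ) : ℂ :=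
  ∏ i ∈ Finset.range k, (z + i) / (i + 1)

lemma risingCoeff_succ (z : ℂ) (k : ℕ) :
    risingCoeff z (k + 1) = risingCoeff z k * ((z + k) / (k + 1)) :=
  Finset.prod_range_succ _ _

lemma mul_risingCoeff_add_one (z : ℂ) (k : ℕ) :
    z * risingCoeff (z + 1) k = risingCoeff z k * (z + k) := by
  induction k with
  | zero => simp [risingCoeff]
  | succ k ih =>
    rw [risingCoeff_succ, risingCoeff_succ, ← mul_assoc, ih]
    push_cast
    ring

lemma risingCoeff_natCast_succ (m k : ℕ) :
    risingCoeff ((m : ℂ) + 1) k = (Nat.choose (m + k) k : ℂ) := by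
  induction k with
  | zero => simp [risingCoeff]
  | succ k ih =>
    rw [risingCoeff_succ, ih]
    have hk : ((k : ℂ) + 1) ≠ 0 := Nat.cast_add_one_ne_zero k
    have h := Nat.add_one_mul_choose_eq (m + k) k
    have h' : ((m + k + 1 : ℕ) : ℂ) * (Nat.choose (m + k) k : ℂ)
        = (Nat.choose (m + k + 1) (k + 1) : ℂ) * ((k + 1 : ℕ) : ℂ) := by exact_mod_cast h
    rw [← add_assoc m k 1, mul_div_assoc', div_eq_iff hk]
    push_cast at h' ⊢
    linear_combination h'

lemma choose_eq_risingCoeff (z : ℂ) (k : ℕ) : Ring.choose (z + k - 1) k = risingCoeff z k := by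
  rw [← Ring.multichoose_eq]
  have h := Ring.factorial_nsmul_multichoose_eq_ascPochhammer z k
  have h2 : (ascPochhammer ℕ k).smeval z = (k.factorial : ℂ) * risingCoeff z k := by
    induction k with
    | zero => simp [risingCoeff, Polynomial.smeval_one]
    | succ k ih =>
      have hk : ((k : ℂ) + 1) ≠ 0 := Nat.cast_add_one_ne_zero k
      rw [ascPochhammer_succ_right, Polynomial.smeval_mul,
        ih (Ring.factorial_nsmul_multichoose_eq_ascPochhammer z k), risingCoeff_succ,
        Nat.factorial_succ]
      simp only [Polynomial.smeval_add, Polynomial.smeval_X, pow_one, Polynomial.smeval_natCast,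
        pow_zero, nsmul_eq_mul, mul_one]
      push_cast
      field_simp
  rw [h2, nsmul_eq_mul] at h
  exact mul_left_cancel₀ (by exact_mod_cast k.factorial_ne_zero) h

lemma norm_risingCoeff_le {z : ℂ} {R : ℝ} (hz : ‖z‖ ≤ R) (k : ℕ) :
    ‖risingCoeff z k‖ ≤ ∏ i ∈ Finset.range k, (R + i) / ((i : ℝ) + 1) := by
  rw [risingCoeff, norm_prod]
  refine Finset.prod_le_prod (fun _ _ => norm_nonneg _) fun i _ => ?_
  have h : ‖(i : ℂ) + 1‖ = (i : ℝ) + 1 := by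
    rw [← Nat.cast_add_one, norm_natCast]; push_cast; rfl
  rw [norm_div, h]
  gcongr
  exact (norm_add_le _ _).trans (by simpa using hz)

lemma summable_rising_mul_geometric {R : ℝ} (hR : 0 < R) :
    Summable fun k : ℕ =>
      (∏ i ∈ Finset.range k, (R + i) / ((i : ℝ) + 1)) * (R + k) * (1 / 2 : ℝ) ^ k := by
  have hpos : ∀ k : ℕ, 0 <
      (∏ i ∈ Finset.range k, (R + i) / ((i : ℝ) + 1)) * (R + k) * (1 / 2 : ℝ) ^ k := fun k =>
    mul_pos (mul_pos (Finset.prod_pos fun i _ => by positivity) (by positivity)) (by positivity)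
  refine summable_of_ratio_test_tendsto_lt_one (l := 1 / 2) (by norm_num)
    (Eventually.of_forall fun k => (hpos k).ne') ?_
  have h : Tendsto (fun k : ℕ => (1 + R / ((k : ℝ) + 1)) * (1 / 2)) atTop (nhds (1 / 2)) := by
    have h1 : Tendsto (fun k : ℕ => R / ((k : ℝ) + 1)) atTop (nhds 0) :=
      (tendsto_natCast_atTop_atTop.atTop_add tendsto_const_nhds).const_div_atTop R
    simpa using (h1.const_add 1).mul_const (1 / 2 : ℝ)
  refine h.congr fun k => ?_
  rw [Real.norm_of_nonneg (hpos _).le, Real.norm_of_nonneg (hpos _).le, Finset.prod_range_succ]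
  have hp : (0 : ℝ) < ∏ i ∈ Finset.range k, (R + i) / ((i : ℝ) + 1) :=
    Finset.prod_pos fun i _ => by positivity
  have hk : (0 : ℝ) < R + k := by positivity
  push_cast
  field_simp
  ring

/-- Sequences of entire functions `c k` whose power series `∑ c k s x ^ k` converges normally on
`|x| ≤ 1 / 2`, locally uniformly in `s`. -/
structure TameCoeff (c : ℕ → ℂ → ℂ) : Prop where
  differentiable : ∀ k, Differentiable ℂ (c k)
  bound : ∀ R : ℝ, ∃ M : ℕ → ℝ, Summable M ∧ ∀ k s, ‖s‖ ≤ R → ‖c k s‖ * (1 / 2 : ℝ) ^ k ≤ M k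

/-- The coefficients of the product of two power series. -/
noncomputable def cauchyMul (c d : ℕ → ℂ → ℂ) (k : ℕ) (s : ℂ) : ℂ :=
  ∑ j ∈ Finset.range (k + 1), c j s * d (k - j) s

namespace TameCoeff

variable {c d : ℕ → ℂ → ℂ}

lemma of_norm_le (hd : TameCoeff d) (hc : ∀ k, Differentiable ℂ (c k)) {K : ℝ}
    (h : ∀ k s, ‖c k s‖ ≤ K * ‖d k s‖) : TameCoeff c where
  differentiable := hc
  bound R := by
    obtain ⟨M, hM, hb⟩ := hd.bound R
    refine ⟨fun k => |K| * M k, hM.mul_left _, fun k s hs => ?_⟩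
    calc ‖c k s‖ * (1 / 2 : ℝ) ^ k ≤ (K * ‖d k s‖) * (1 / 2 : ℝ) ^ k := by gcongr; exact h k s
      _ ≤ (|K| * ‖d k s‖) * (1 / 2 : ℝ) ^ k := by gcongr; exact le_abs_self K
      _ = |K| * (‖d k s‖ * (1 / 2 : ℝ) ^ k) := by ring
      _ ≤ |K| * M k := mul_le_mul_of_nonneg_left (hb k s hs) (abs_nonneg K)

lemma alternating (hc : TameCoeff c) : TameCoeff fun k s => (-1 : ℂ) ^ k * c k s :=
  hc.of_norm_le (K := 1) (fun k => (hc.differentiable k).const_mul _) fun k s => by simp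

lemma mul (hc : TameCoeff c) (hd : TameCoeff d) :
    TameCoeff (cauchyMul c d) where
  differentiable k := Differentiable.fun_sum fun j _ =>
    (hc.differentiable j).mul (hd.differentiable (k - j))
  bound R := by
    obtain ⟨M, hM, hb⟩ := hc.bound R
    obtain ⟨N, hN, hb'⟩ := hd.bound R
    refine ⟨fun k => ∑ j ∈ Finset.range (k + 1), M j * N (k - j),
      (summable_norm_sum_mul_range_of_summable_norm hM.norm hN.norm).of_norm, fun k s hs => ?_⟩
    calc _ ≤ (∑ j ∈ Finset.range (k + 1), ‖c j s * d (k - j) s‖) * (1 / 2 : ℝ) ^ k := by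
          gcongr; exact norm_sum_le _ _
      _ = ∑ j ∈ Finset.range (k + 1),
          (‖c j s‖ * (1 / 2 : ℝ) ^ j) * (‖d (k - j) s‖ * (1 / 2 : ℝ) ^ (k - j)) := by
          rw [Finset.sum_mul]
          refine Finset.sum_congr rfl fun j hj => ?_
          rw [norm_mul, ← Nat.add_sub_of_le (Nat.lt_succ_iff.mp (Finset.mem_range.mp hj)), pow_add,
            Nat.add_sub_cancel_left]
          ring
      _ ≤ _ := Finset.sum_le_sum fun j _ => mul_le_mul (hb j s hs) (hb' _ s hs) (by positivity)
          ((by positivity : (0 : ℝ) ≤ ‖c j s‖ * (1 / 2 : ℝ) ^ j).trans (hb j s hs))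

lemma summable_norm (hc : TameCoeff c) (s : ℂ) : Summable fun k => ‖c k s‖ * (1 / 2 : ℝ) ^ k := by
  obtain ⟨M, hM, hb⟩ := hc.bound ‖s‖
  exact hM.of_nonneg_of_le (fun k => by positivity) fun k => hb k s le_rfl

lemma summable_norm_mul_pow (hc : TameCoeff c) (s : ℂ) {x : ℂ} (hx : ‖x‖ ≤ 1 / 2) :
    Summable fun k => ‖c k s * x ^ k‖ := by
  refine (hc.summable_norm s).of_nonneg_of_le (fun k => norm_nonneg _) fun k => ?_
  rw [norm_mul, norm_pow]
  gcongr

lemma tsum_mul_tsum (hc : TameCoeff c) (hd : TameCoeff d) (s : ℂ) {x : ℂ} (hx : ‖x‖ ≤ 1 / 2) :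
    (∑' k, c k s * x ^ k) * (∑' k, d k s * x ^ k) =
      ∑' k, cauchyMul c d k s * x ^ k := by
  rw [tsum_mul_tsum_eq_tsum_sum_range_of_summable_norm (hc.summable_norm_mul_pow s hx)
    (hd.summable_norm_mul_pow s hx)]
  refine tsum_congr fun k => ?_
  rw [cauchyMul, Finset.sum_mul]
  refine Finset.sum_congr rfl fun j hj => ?_
  have h : x ^ k = x ^ j * x ^ (k - j) := by
    rw [← pow_add, Nat.add_sub_of_le (Nat.lt_succ_iff.mp (Finset.mem_range.mp hj))]
  rw [h]
  ring

end TameCoeff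

/-- The Taylor coefficients at `x = 0` of the function `x ↦ -s ζ(1 - s, 1 - x)`. -/
noncomputable def hurwitzCoeff (k : ℕ) (s : ℂ) : ℂ :=
  risingCoeff (-s) k * zetaEntire (1 - s + k)

lemma tameCoeff_hurwitzCoeff : TameCoeff hurwitzCoeff where
  differentiable k := by
    refine Differentiable.mul ?_ (differentiable_zetaEntire.comp (by fun_prop))
    unfold risingCoeff
    fun_prop
  bound R := by
    obtain ⟨C, hC, hb⟩ := exists_norm_zetaEntire_le
    have hd : ∀ k, ContinuousOn (hurwitzCoeff k) (Metric.closedBall 0 R) := fun k => by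
      refine (Differentiable.mul ?_ (differentiable_zetaEntire.comp
        (by fun_prop : Differentiable ℂ fun s : ℂ => 1 - s + k))).continuous.continuousOn
      unfold risingCoeff
      fun_prop
    choose B hB using fun k => (isCompact_closedBall (0 : ℂ) R).exists_bound_of_continuousOn (hd k)
    set P : ℕ → ℝ := fun k => C * ((∏ i ∈ Finset.range k, ((|R| + 1) + i) / ((i : ℝ) + 1)) *
      ((|R| + 1) + k) * (1 / 2 : ℝ) ^ k) with hP
    have hPs : Summable P := (summable_rising_mul_geometric (by positivity)).mul_left C
    refine ⟨fun k => if (k : ℝ) < |R| + 1 then B k * (1 / 2 : ℝ) ^ k else P k, ?_, fun k s hs => ?_⟩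
    · refine (summable_congr_cofinite ?_).mpr hPs
      rw [Nat.cofinite_eq_atTop]
      filter_upwards [eventually_ge_atTop ⌈|R| + 1⌉₊] with k hk
      rw [if_neg (not_lt.mpr (Nat.ceil_le.mp hk))]
    · dsimp only
      split_ifs with hk
      · gcongr
        exact hB k s (by simpa using hs)
      · have hs' : ‖s‖ ≤ |R| := hs.trans (le_abs_self R)
        have hre := (abs_le.mp ((Complex.abs_re_le_norm s).trans hs')).2
        have h2 : 2 ≤ (1 - s + k : ℂ).re := by simp; linarith
        have h3 : ‖(1 - s + k : ℂ) - 1‖ ≤ |R| + 1 + k := by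
          have : (1 - s + k : ℂ) - 1 = k - s := by ring
          rw [this]
          refine (norm_sub_le _ _).trans ?_
          rw [norm_natCast]
          linarith
        rw [hurwitzCoeff, norm_mul, hP]
        calc _ ≤ ((∏ i ∈ Finset.range k, ((|R| + 1) + i) / ((i : ℝ) + 1)) *
              (C * (|R| + 1 + k))) * (1 / 2 : ℝ) ^ k := by
              gcongr
              · exact norm_risingCoeff_le (by rw [norm_neg]; linarith) k
              · exact (hb _ h2).trans (by gcongr)
          _ = _ := by ring

lemma hurwitzCoeff_neg_natCast {m : ℕ} (hm : 0 < m) (k : ℕ) :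
    hurwitzCoeff k (-(m : ℂ)) =
      m * ((Nat.choose (m + k) k : ℂ) * riemannZeta ((1 + m + k : ℕ) : ℂ)) := by
  have hne : ((1 + m + k : ℕ) : ℂ) ≠ 1 := by norm_cast; lia
  have harg : 1 - -(m : ℂ) + k = ((1 + m + k : ℕ) : ℂ) := by push_cast; ring
  rw [hurwitzCoeff, harg, zetaEntire_of_ne hne, neg_neg, ← risingCoeff_natCast_succ]
  have := mul_risingCoeff_add_one m k
  push_cast
  linear_combination (-riemannZeta (1 + m + k)) * this

lemma TameCoeff.differentiable_tsum {c : ℕ → ℂ → ℂ} (hc : TameCoeff c) {x : ℂ}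
    (hx : ‖x‖ ≤ 1 / 2) : Differentiable ℂ fun s => ∑' k, c k s * x ^ k := by
  intro s
  obtain ⟨M, hM, hb⟩ := hc.bound (‖s‖ + 1)
  refine (differentiableOn_tsum_of_summable_norm hM
    (fun k => ((hc.differentiable k).mul_const _).differentiableOn) Metric.isOpen_ball
    (fun k w hw => ?_)).differentiableAt (Metric.isOpen_ball.mem_nhds (x := s)
      (s := Metric.ball 0 (‖s‖ + 1)) (by simp))
  refine le_trans ?_ (hb k w (by simpa using (mem_ball_zero_iff.mp hw).le))
  rw [norm_mul, norm_pow]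
  gcongr

lemma hasSum_risingCoeff_mul_pow (w : ℂ) {t : ℂ} (ht : ‖t‖ < 1) :
    HasSum (fun k => risingCoeff w k * t ^ k) (1 / (1 - t) ^ w) := by
  have h := (one_div_one_sub_cpow_hasFPowerSeriesOnBall_zero w).hasSum (y := t) (by
    simpa [Metric.mem_eball, edist_zero_right, enorm_eq_nnnorm, ← NNReal.coe_lt_coe] using ht)
  simpa [FormalMultilinearSeries.ofScalars_apply_eq, choose_eq_risingCoeff, mul_comm] using h

lemma tsum_hurwitzCoeff_of_re_neg {s : ℂ} (hs : s.re < 0) {y : ℝ} (hy : |y| ≤ 1 / 2) :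
    ∑' k, hurwitzCoeff k s * (y : ℂ) ^ k =
      -s * ∑' n : ℕ, 1 / ((n : ℂ) + 1 - y) ^ (1 - s) := by
  set w := 1 - s with hw
  have hwre : 1 < w.re := by simp [hw]; linarith
  have hy' : ‖(y : ℂ)‖ ≤ 1 / 2 := by simpa using hy
  have hpos : ∀ n : ℕ, (0 : ℝ) < (n : ℝ) + 1 := fun n => by positivity
  have hne : ∀ n : ℕ, ((n : ℂ) + 1) ≠ 0 := Nat.cast_add_one_ne_zero
  set f : ℕ → ℕ → ℂ := fun n k => risingCoeff w k * (y : ℂ) ^ k * (1 / ((n : ℂ) + 1) ^ (w + k))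
    with hf
  have hexp : ∀ n : ℕ, 1 / ((n : ℂ) + 1 - y) ^ w = ∑' k, f n k := by
    intro n
    have ht : ‖(y : ℂ) / ((n : ℂ) + 1)‖ < 1 := by
      have hn : ‖(n : ℂ) + 1‖ = (n : ℝ) + 1 := by
        rw [← Nat.cast_add_one, norm_natCast]; push_cast; rfl
      rw [norm_div, hn, div_lt_one (hpos n)]
      linarith [Nat.cast_nonneg (α := ℝ) n]
    have hfac : ((n : ℂ) + 1 - y) = (((n : ℝ) + 1 : ℝ) : ℂ) * ((1 - y / ((n : ℝ) + 1) : ℝ) : ℂ) := by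
      push_cast
      field_simp [hne n]
    have h1 : 0 ≤ 1 - y / ((n : ℝ) + 1) := by
      have := (abs_le.mp hy).2
      rw [sub_nonneg, div_le_one (hpos n)]
      linarith [Nat.cast_nonneg (α := ℝ) n]
    rw [hfac, mul_cpow_ofReal_nonneg (hpos n).le h1, one_div, mul_inv, ← one_div, ← one_div]
    have hsum := (hasSum_risingCoeff_mul_pow w ht).mul_left (1 / ((n : ℂ) + 1) ^ w)
    push_cast
    rw [← hsum.tsum_eq]
    refine tsum_congr fun k => ?_
    simp only [hf]
    rw [cpow_add _ _ (hne n), cpow_natCast, div_pow]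
    have := pow_ne_zero k (hne n)
    have h2 : ((n : ℂ) + 1) ^ w ≠ 0 := by simp [cpow_eq_zero_iff, hne n]
    field_simp
  have hsr : Summable fun k : ℕ => ‖risingCoeff w k‖ * (1 / 2 : ℝ) ^ k := by
    refine (summable_rising_mul_geometric (R := ‖w‖ + 1) (by positivity)).of_nonneg_of_le
      (fun k => by positivity) fun k => ?_
    gcongr
    have hR := norm_risingCoeff_le (z := w) (R := ‖w‖ + 1) (by linarith) k
    refine hR.trans (le_mul_of_one_le_right ((norm_nonneg _).trans hR) ?_)
    have := norm_nonneg w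
    linarith [Nat.cast_nonneg (α := ℝ) k]
  have hsz : Summable fun n : ℕ => 1 / ((n : ℝ) + 1) ^ w.re := by
    simpa using (summable_nat_add_iff 1).mpr (Real.summable_one_div_nat_rpow.mpr hwre)
  have hsummable : Summable (Function.uncurry f) := by
    refine Summable.of_norm_bounded (hsz.mul_of_nonneg hsr (fun n => ?_) (fun k => ?_)) ?_
    · have := hpos n
      change (0 : ℝ) ≤ 1 / ((n : ℝ) + 1) ^ w.re
      positivity
    · change (0 : ℝ) ≤ ‖risingCoeff w k‖ * (1 / 2 : ℝ) ^ k
      positivity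
    · rintro ⟨n, k⟩
      have hc : ((n : ℂ) + 1) = (((n : ℝ) + 1 : ℝ) : ℂ) := by push_cast; rfl
      simp only [Function.uncurry, hf]
      rw [norm_mul, norm_mul, norm_div, norm_one, hc, norm_cpow_eq_rpow_re_of_pos (hpos n),
        norm_pow, mul_comm, add_re, natCast_re]
      have := hpos n
      gcongr
      · linarith [Nat.cast_nonneg (α := ℝ) n]
      · simp
  rw [tsum_congr hexp, ← hsummable.tsum_comm, ← tsum_mul_left]
  refine tsum_congr fun k => ?_
  simp only [hf]
  have hk : 1 < (w + k).re := by simp; linarith [Nat.cast_nonneg (α := ℝ) k]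
  have hk1 : w + k ≠ 1 := by intro h; rw [h] at hk; simp at hk
  rw [tsum_mul_left, ← zeta_eq_tsum_one_div_nat_add_one_cpow hk, hurwitzCoeff, ← hw,
    zetaEntire_of_ne hk1]
  have h := mul_risingCoeff_add_one (-s) k
  rw [show -s + 1 = w by rw [hw]; ring] at h
  have hs' : w + k - 1 = -s + k := by rw [hw]; ring
  rw [hs']
  linear_combination (-(y : ℂ) ^ k * riemannZeta (w + k)) * h

lemma eq_of_eq_of_re_neg {f g : ℂ → ℂ} (hf : ∀ s ≠ 0, DifferentiableAt ℂ f s)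
    (hg : ∀ s ≠ 0, DifferentiableAt ℂ g s) (h : ∀ s : ℂ, s.re < 0 → f s = g s) {s : ℂ}
    (hs : s ≠ 0) : f s = g s := by
  have hf' : AnalyticOnNhd ℂ f {0}ᶜ := DifferentiableOn.analyticOnNhd
    (fun z hz => (hf z hz).differentiableWithinAt) isOpen_compl_singleton
  have hg' : AnalyticOnNhd ℂ g {0}ᶜ := DifferentiableOn.analyticOnNhd
    (fun z hz => (hg z hz).differentiableWithinAt) isOpen_compl_singleton
  refine hf'.eqOn_of_preconnected_of_eventuallyEq hg' (z₀ := -1)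
    (isConnected_compl_singleton_of_one_lt_rank (by simp) 0).isPreconnected
    (by simp) ?_ hs
  filter_upwards [(isOpen_lt continuous_re continuous_const).mem_nhds
    (show (-1 : ℂ).re < 0 by simp)] with z hz using h z hz

lemma differentiableAt_neg_mul_hurwitzZeta (a : UnitAddCircle) {s : ℂ} (hs : s ≠ 0) :
    DifferentiableAt ℂ (fun s => -s * hurwitzZeta a (1 - s)) s :=
  differentiableAt_id.neg.mul <| (differentiableAt_hurwitzZeta a (s := 1 - s) (by simpa using hs)).comp
    (f := fun s => 1 - s) s (by fun_prop)

lemma neg_mul_hurwitzZeta_one_sub {x : ℝ} (hx : x ∈ Set.Ioo 0 (1 / 2)) {s : ℂ} (hs : s ≠ 0) :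
    -s * hurwitzZeta ((1 - x : ℝ) : UnitAddCircle) (1 - s) =
      ∑' k, hurwitzCoeff k s * (x : ℂ) ^ k := by
  have hx' : |x| ≤ 1 / 2 := by rw [abs_of_pos hx.1]; exact hx.2.le
  refine eq_of_eq_of_re_neg (fun z hz => differentiableAt_neg_mul_hurwitzZeta _ hz)
    (fun z _ => tameCoeff_hurwitzCoeff.differentiable_tsum (x := x) (by simpa using hx') z)
    (fun z hz => ?_) hs
  rw [tsum_hurwitzCoeff_of_re_neg hz hx', ← (hasSum_hurwitzZeta_of_one_lt_re
    (a := 1 - x) ⟨by linarith [hx.2], by linarith [hx.1]⟩ (by rw [sub_re, one_re]; linarith)).tsum_eq]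
  congr 1
  refine tsum_congr fun n => ?_
  push_cast
  ring_nf

lemma neg_mul_hurwitzZeta {x : ℝ} (hx : x ∈ Set.Ioo 0 (1 / 2)) {s : ℂ} (hs : s ≠ 0) :
    -s * hurwitzZeta (x : UnitAddCircle) (1 - s) =
      -s * (x : ℂ) ^ (s - 1) + ∑' k, (-1 : ℂ) ^ k * hurwitzCoeff k s * (x : ℂ) ^ k := by
  have hx' : |x| ≤ 1 / 2 := by rw [abs_of_pos hx.1]; exact hx.2.le
  have hx0 : (x : ℂ) ≠ 0 := by exact_mod_cast hx.1.ne'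
  refine eq_of_eq_of_re_neg (f := fun s => -s * hurwitzZeta (x : UnitAddCircle) (1 - s))
    (g := fun s => -s * (x : ℂ) ^ (s - 1) + ∑' k, (-1 : ℂ) ^ k * hurwitzCoeff k s * (x : ℂ) ^ k)
    (fun z hz => differentiableAt_neg_mul_hurwitzZeta _ hz)
    (fun z _ => ?_) (fun z hz => ?_) hs
  · refine DifferentiableAt.add (differentiableAt_id.neg.mul ?_)
      (tameCoeff_hurwitzCoeff.alternating.differentiable_tsum (x := x) (by simpa using hx') z)
    exact (differentiableAt_id.sub_const 1).const_cpow (Or.inl hx0)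
  · have h := tsum_hurwitzCoeff_of_re_neg hz (y := -x) (by rwa [abs_neg])
    have h2 : ∑' k, (-1 : ℂ) ^ k * hurwitzCoeff k z * (x : ℂ) ^ k =
        ∑' k, hurwitzCoeff k z * ((-x : ℝ) : ℂ) ^ k := tsum_congr fun k => by
      push_cast
      rw [neg_pow]
      ring
    have hz1 := hasSum_hurwitzZeta_of_one_lt_re (a := x) (s := 1 - z)
      ⟨hx.1.le, by linarith [hx.2]⟩ (by rw [sub_re, one_re]; linarith)
    rw [h2, h, ← mul_add, ← hz1.tsum_eq, hz1.summable.tsum_eq_zero_add]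
    congr 2
    · rw [Nat.cast_zero, zero_add, one_div, ← cpow_neg, neg_sub]
    · refine tsum_congr fun n => ?_
      push_cast
      ring_nf

/-- The term `c k s ∫₀^{1/2} x ^ (β s + k - 1) dx`, in closed form. -/
noncomputable def mellinTerm (c : ℕ → ℂ → ℂ) (β : ℂ → ℂ) (k : ℕ) (s : ℂ) : ℂ :=
  c k s * ((1 / 2 : ℂ) ^ (β s + k) / (β s + k))

/-- The continuation of `∫₀^{1/2} x ^ (β s - 1) ∑ c k s x ^ k dx` in `s`. -/
noncomputable def mellinSum (c : ℕ → ℂ → ℂ) (β : ℂ → ℂ) (s : ℂ) : ℂ :=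
  ∑' k, mellinTerm c β k s

namespace TameCoeff

variable {c : ℕ → ℂ → ℂ} {β : ℂ → ℂ}

lemma intervalIntegrable (hc : TameCoeff c) (s : ℂ) {b : ℂ} (hb : 0 < b.re) :
    IntervalIntegrable (fun x : ℝ => (x : ℂ) ^ (b - 1) * ∑' k, c k s * (x : ℂ) ^ k)
      volume 0 (1 / 2) := by
  refine IntervalIntegrable.mul_continuousOn
    (intervalIntegral.intervalIntegrable_cpow' (by rw [sub_re, one_re]; linarith)) ?_
  refine continuousOn_tsum (fun k => by fun_prop) (hc.summable_norm s) fun k x hx => ?_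
  rw [Set.uIcc_of_le (by norm_num)] at hx
  rw [norm_mul, norm_pow, norm_real, Real.norm_of_nonneg hx.1]
  have := hx.1
  have := hx.2
  gcongr

lemma integral_eq_mellinSum (hc : TameCoeff c) {s : ℂ} (hb : 0 < (β s).re) :
    ∫ x in (0 : ℝ)..1 / 2, (x : ℂ) ^ (β s - 1) * ∑' k, c k s * (x : ℂ) ^ k = mellinSum c β s := by
  have hhalf : (0 : ℝ) ≤ 1 / 2 := by norm_num
  have hsum := intervalIntegral.hasSum_integral_of_dominated_convergence (μ := volume)
    (a := 0) (b := 1 / 2)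
    (F := fun k x => (x : ℂ) ^ (β s - 1) * (c k s * (x : ℂ) ^ k))
    (f := fun x => (x : ℂ) ^ (β s - 1) * ∑' k, c k s * (x : ℂ) ^ k)
    (fun k x => x ^ ((β s).re - 1) * (‖c k s‖ * (1 / 2 : ℝ) ^ k))
    (fun k => by
      have h := intervalIntegral.intervalIntegrable_cpow' (a := 0) (b := 1 / 2) (r := β s - 1)
        (by rw [sub_re, one_re]; linarith)
      exact (h.mul_continuousOn (g := fun x : ℝ => c k s * (x : ℂ) ^ k)
        (by fun_prop)).aestronglyMeasurable_restrict_uIoc)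
    (fun k => Eventually.of_forall fun x hx => by
      rw [Set.uIoc_of_le hhalf] at hx
      rw [norm_mul, norm_mul, norm_pow, norm_cpow_eq_rpow_re_of_pos hx.1, norm_real,
        Real.norm_of_nonneg hx.1.le, sub_re, one_re]
      have := hx.1
      have := hx.2
      gcongr)
    (Eventually.of_forall fun x _ => (hc.summable_norm s).mul_left _)
    (by
      simp_rw [tsum_mul_left]
      exact (intervalIntegral.intervalIntegrable_rpow' (by linarith)).mul_const _)
    (Eventually.of_forall fun x hx => by
      rw [Set.uIoc_of_le hhalf] at hx
      refine (Summable.hasSum ?_).mul_left _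
      refine (hc.summable_norm_mul_pow s ?_).of_norm
      rw [norm_real, Real.norm_of_nonneg hx.1.le]
      exact hx.2)
  rw [← hsum.tsum_eq, mellinSum]
  refine tsum_congr fun k => ?_
  have hk : 0 < (β s + k).re := by
    rw [add_re, natCast_re]
    positivity
  have hk0 : β s + k ≠ 0 := fun h => by simp [h] at hk
  have hint : ∫ x in (0 : ℝ)..1 / 2, (x : ℂ) ^ (β s - 1) * (c k s * (x : ℂ) ^ k) =
      ∫ x in (0 : ℝ)..1 / 2, c k s * (x : ℂ) ^ (β s + k - 1) := by
    refine intervalIntegral.integral_congr_Ioo_of_le hhalf fun x hx => ?_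
    have hx0 : (x : ℂ) ≠ 0 := by exact_mod_cast hx.1.ne'
    rw [show β s + k - 1 = (β s - 1) + k by ring, cpow_add _ _ hx0, cpow_natCast]
    ring
  rw [hint, intervalIntegral.integral_const_mul, mellinTerm,
    integral_cpow (Or.inl (by rw [sub_re, one_re]; linarith)), sub_add_cancel, ofReal_zero,
    zero_cpow hk0, sub_zero]
  norm_num

lemma exists_mellinSum_eq_sum_add (hc : TameCoeff c) (hβ : Differentiable ℂ β) (z : ℂ) :
    ∃ N₀ : ℕ, ∀ N ≥ N₀, ∃ g : ℂ → ℂ, AnalyticAt ℂ g z ∧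
      ∀ᶠ s in nhds z, mellinSum c β s = (∑ k ∈ Finset.range N, mellinTerm c β k s) + g s := by
  obtain ⟨B, hB⟩ := (isCompact_closedBall (0 : ℂ) (‖z‖ + 1)).exists_bound_of_continuousOn
    hβ.continuous.continuousOn
  refine ⟨⌈B + 1⌉₊, fun N hN => ?_⟩
  have hBN : B + 1 ≤ N := Nat.ceil_le.mp hN
  obtain ⟨M, hM, hMb⟩ := hc.bound (‖z‖ + 1)
  have hz : Metric.ball (0 : ℂ) (‖z‖ + 1) ∈ nhds z :=
    Metric.isOpen_ball.mem_nhds (by simp)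
  have hden : ∀ (k : ℕ) (s : ℂ), s ∈ Metric.ball (0 : ℂ) (‖z‖ + 1) →
      1 ≤ ‖β s + (k + N : ℕ)‖ := fun k s hs => by
    have h1 := hB s (Metric.ball_subset_closedBall hs)
    have h2 := (abs_le.mp ((Complex.abs_re_le_norm _).trans h1)).1
    refine le_trans ?_ (Complex.re_le_norm _)
    rw [add_re, natCast_re]
    push_cast
    linarith [Nat.cast_nonneg (α := ℝ) k]
  have hbound : ∀ (k : ℕ) (s : ℂ), s ∈ Metric.ball (0 : ℂ) (‖z‖ + 1) →
      ‖mellinTerm c β (k + N) s‖ ≤ (1 / 2 : ℝ) ^ (-B) * M (k + N) := fun k s hs => by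
    have h1 := hB s (Metric.ball_subset_closedBall hs)
    have h2 := (abs_le.mp ((Complex.abs_re_le_norm _).trans h1)).1
    have hhalf : (1 / 2 : ℂ) = ((1 / 2 : ℝ) : ℂ) := by push_cast; rfl
    rw [mellinTerm, norm_mul, norm_div, hhalf, norm_cpow_eq_rpow_re_of_pos (by norm_num), add_re,
      natCast_re, Real.rpow_add (by norm_num), Real.rpow_natCast]
    calc _ ≤ ‖c (k + N) s‖ * ((1 / 2 : ℝ) ^ (β s).re * (1 / 2 : ℝ) ^ (k + N)) :=
          mul_le_mul_of_nonneg_left (div_le_self (by positivity) (hden k s hs)) (norm_nonneg _)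
      _ = (1 / 2 : ℝ) ^ (β s).re * (‖c (k + N) s‖ * (1 / 2 : ℝ) ^ (k + N)) := by ring
      _ ≤ _ := mul_le_mul
          (Real.rpow_le_rpow_of_exponent_ge (by norm_num) (by norm_num) h2)
          (hMb _ s (mem_ball_zero_iff.mp hs).le) (by positivity) (by positivity)
  have hMs : Summable fun k => (1 / 2 : ℝ) ^ (-B) * M (k + N) :=
    ((summable_nat_add_iff N).mpr hM).mul_left _
  refine ⟨fun s => ∑' k, mellinTerm c β (k + N) s, ?_, ?_⟩
  · refine DifferentiableOn.analyticAt (differentiableOn_tsum_of_summable_norm hMs (fun k s hs => ?_)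
      Metric.isOpen_ball hbound) hz
    have hne : β s + (k + N : ℕ) ≠ 0 := fun h => by
      have := hden k s hs
      rw [h, norm_zero] at this
      linarith
    have hβ' : DifferentiableAt ℂ (fun s => β s + (k + N : ℕ)) s := (hβ s).add_const _
    exact (((hc.differentiable _) s).mul
      ((hβ'.const_cpow (Or.inl (by norm_num))).div hβ' hne)).differentiableWithinAt
  · filter_upwards [hz] with s hs
    exact (Summable.sum_add_tsum_nat_add'
      (Summable.of_norm_bounded hMs fun k => hbound k s hs)).symm

lemma meromorphicAt_mellinSum (hc : TameCoeff c) (hβ : Differentiable ℂ β) (z : ℂ) :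
    MeromorphicAt (mellinSum c β) z := by
  obtain ⟨N, hN⟩ := hc.exists_mellinSum_eq_sum_add hβ z
  obtain ⟨g, hg, heq⟩ := hN N le_rfl
  refine MeromorphicAt.congr (f := fun s => (∑ k ∈ Finset.range N, mellinTerm c β k s) + g s)
    (.add (.fun_sum fun k _ => ?_) hg.meromorphicAt)
    ((heq.filter_mono nhdsWithin_le_nhds).mono fun s hs => hs.symm)
  have hβ' : Differentiable ℂ fun s => β s + k := hβ.add_const _
  exact ((hc.differentiable k).analyticAt z).meromorphicAt.mul
    ((((hβ'.const_cpow (Or.inl (by norm_num))).analyticAt z).meromorphicAt).div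
      (hβ'.analyticAt z).meromorphicAt)

lemma tendsto_sub_mul_mellinTerm (hc : TameCoeff c) (hβ : Differentiable ℂ β) {z : ℂ} {k : ℕ}
    (hk : β z + k ≠ 0) :
    Tendsto (fun s => (s - z) * mellinTerm c β k s) (nhdsWithin z {z}ᶜ) (nhds 0) := by
  have hβ' : DifferentiableAt ℂ (fun s => β s + k) z := (hβ z).add_const _
  have h : DifferentiableAt ℂ (mellinTerm c β k) z :=
    ((hc.differentiable k) z).mul ((hβ'.const_cpow (Or.inl (by norm_num))).div hβ' hk)
  have h2 : DifferentiableAt ℂ (fun s => (s - z) * mellinTerm c β k s) z :=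
    (differentiableAt_id.sub_const z).mul h
  simpa using h2.continuousAt.tendsto.mono_left nhdsWithin_le_nhds

lemma tendsto_sub_mul_mellinSum_of_term (hc : TameCoeff c) (hβ : Differentiable ℂ β) {z L : ℂ}
    {k₀ : ℕ} (hL : Tendsto (fun s => (s - z) * mellinTerm c β k₀ s) (nhdsWithin z {z}ᶜ) (nhds L))
    (hne : ∀ k ≠ k₀, β z + k ≠ 0) :
    Tendsto (fun s => (s - z) * mellinSum c β s) (nhdsWithin z {z}ᶜ) (nhds L) := by
  obtain ⟨N, hN⟩ := hc.exists_mellinSum_eq_sum_add hβ z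
  obtain ⟨g, hg, heq⟩ := hN (max N (k₀ + 1)) (le_max_left _ _)
  have hsum : Tendsto (fun s => (∑ k ∈ Finset.range (max N (k₀ + 1)), (s - z) * mellinTerm c β k s)
      + (s - z) * g s) (nhdsWithin z {z}ᶜ)
      (nhds ((∑ k ∈ Finset.range (max N (k₀ + 1)), if k = k₀ then L else 0) + 0)) := by
    refine Tendsto.add (tendsto_finsetSum _ fun k _ => ?_) ?_
    · split_ifs with h
      · exact h ▸ hL
      · exact hc.tendsto_sub_mul_mellinTerm hβ (hne k h)
    · have h2 : DifferentiableAt ℂ (fun s => (s - z) * g s) z :=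
        (differentiableAt_id.sub_const z).mul hg.differentiableAt
      simpa using h2.continuousAt.tendsto.mono_left nhdsWithin_le_nhds
  rw [Finset.sum_ite_eq', if_pos (Finset.mem_range.mpr (by simp)), add_zero] at hsum
  refine hsum.congr' ?_
  filter_upwards [heq.filter_mono nhdsWithin_le_nhds] with s hs
  rw [hs, mul_add, Finset.mul_sum]

lemma tendsto_sub_mul_mellinSum_zero (hc : TameCoeff c) (hβ : Differentiable ℂ β) {z : ℂ}
    (hne : ∀ k : ℕ, β z + k ≠ 0) :
    Tendsto (fun s => (s - z) * mellinSum c β s) (nhdsWithin z {z}ᶜ) (nhds 0) :=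
  hc.tendsto_sub_mul_mellinSum_of_term hβ (hc.tendsto_sub_mul_mellinTerm hβ (hne 0))
    fun k _ => hne k

lemma tendsto_sub_mul_mellinSum_affine (hc : TameCoeff c) {p q z : ℂ} {k₀ : ℕ} (hp : p ≠ 0)
    (hz : p * z + q + k₀ = 0) :
    Tendsto (fun s => (s - z) * mellinSum c (fun s => p * s + q) s) (nhdsWithin z {z}ᶜ)
      (nhds (c k₀ z / p)) := by
  refine hc.tendsto_sub_mul_mellinSum_of_term (by fun_prop) ?_ (k₀ := k₀) fun k hk h => hk ?_
  · have hcont : ContinuousAt (fun s => c k₀ s * (1 / 2 : ℂ) ^ (p * s + q + k₀) / p) z := by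
      refine DifferentiableAt.continuousAt (𝕜 := ℂ) (DifferentiableAt.div_const
        (((hc.differentiable k₀) z).mul (DifferentiableAt.const_cpow (by fun_prop)
          (Or.inl (by norm_num)))) _)
    have h := hcont.tendsto.mono_left (nhdsWithin_le_nhds (s := {z}ᶜ))
    rw [hz, cpow_zero, mul_one] at h
    refine h.congr' ?_
    filter_upwards [self_mem_nhdsWithin] with s hs
    have hsz : s - z ≠ 0 := sub_ne_zero.mpr hs
    have hlin : p * s + q + k₀ = p * (s - z) := by linear_combination hz
    rw [mellinTerm, hlin]
    field_simp
  · have : (k : ℂ) = k₀ := by linear_combination h - hz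
    exact_mod_cast this

end TameCoeff

/-- The coefficients of the expansion of `-s ζ(1 - s, 1 + x)` around `x = 0`. -/
noncomputable def hurwitzCoeffAlt (k : ℕ) (s : ℂ) : ℂ :=
  (-1 : ℂ) ^ k * hurwitzCoeff k s

lemma tameCoeff_hurwitzCoeffAlt : TameCoeff hurwitzCoeffAlt :=
  tameCoeff_hurwitzCoeff.alternating

/-- The continuation in `s` of `∫₀¹ ζ(1 - s, x) ζ(1 - s, 1 - x)² dx`. -/
noncomputable def wittenIntegral (s : ℂ) : ℂ :=
  ((-s) ^ 3)⁻¹ *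
    (-s * (mellinSum (cauchyMul hurwitzCoeff hurwitzCoeff) (fun s => 1 * s + 0) s +
        2 * mellinSum (cauchyMul hurwitzCoeffAlt hurwitzCoeff) (fun s => 1 * s + 0) s) +
      s ^ 2 * mellinSum hurwitzCoeff (fun s => 2 * s + -1) s +
      (mellinSum (cauchyMul hurwitzCoeffAlt (cauchyMul hurwitzCoeff hurwitzCoeff)) (fun _ => 1) s +
        mellinSum (cauchyMul hurwitzCoeffAlt (cauchyMul hurwitzCoeffAlt hurwitzCoeff))
          (fun _ => 1) s))

lemma meromorphicAt_wittenIntegral (z : ℂ) : MeromorphicAt wittenIntegral z := by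
  have hA := tameCoeff_hurwitzCoeff
  have hE := tameCoeff_hurwitzCoeffAlt
  have hid : MeromorphicAt (fun s : ℂ => s) z := analyticAt_id.meromorphicAt
  have h1 := (hA.mul hA).meromorphicAt_mellinSum (β := fun s => 1 * s + 0) (by fun_prop) z
  have h2 := (hE.mul hA).meromorphicAt_mellinSum (β := fun s => 1 * s + 0) (by fun_prop) z
  have h3 := hA.meromorphicAt_mellinSum (β := fun s => 2 * s + -1) (by fun_prop) z
  have h4 := (hE.mul (hA.mul hA)).meromorphicAt_mellinSum (β := fun _ => 1) (by fun_prop) z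
  have h5 := (hE.mul (hE.mul hA)).meromorphicAt_mellinSum (β := fun _ => 1) (by fun_prop) z
  exact ((hid.neg.pow 3).inv).mul (((hid.neg.mul (h1.add ((MeromorphicAt.const 2 z).mul h2))).add
    ((hid.pow 2).mul h3)).add (h4.add h5))

lemma integral_Ioo_eq_add_reflect {E : Type*} [NormedAddCommGroup E] [NormedSpace ℝ E]
    {f g h : ℝ → E} (hf : Set.EqOn f g (Set.Ioo 0 (1 / 2)))
    (hr : ∀ x ∈ Set.Ioo (0 : ℝ) (1 / 2), f (1 - x) = h x)
    (hg : IntervalIntegrable g volume 0 (1 / 2)) (hh : IntervalIntegrable h volume 0 (1 / 2)) :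
    ∫ x in Set.Ioo (0 : ℝ) 1, f x =
      (∫ x in (0 : ℝ)..1 / 2, g x) + ∫ x in (0 : ℝ)..1 / 2, h x := by
  have h0 : (0 : ℝ) ≤ 1 / 2 := by norm_num
  have hf1 : IntervalIntegrable f volume 0 (1 / 2) := hg.congr_uIoo (by
    rw [Set.uIoo_of_le h0]; exact hf.symm)
  have hf2 : IntervalIntegrable (fun x => f (1 - x)) volume 0 (1 / 2) := hh.congr_uIoo (by
    rw [Set.uIoo_of_le h0]; exact fun x hx => (hr x hx).symm)
  have hf3 : IntervalIntegrable f volume (1 / 2) 1 := by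
    have := (hf2.comp_sub_left 1 (by finiteness)).symm
    norm_num at this
    exact this
  rw [← integral_Ioc_eq_integral_Ioo, ← intervalIntegral.integral_of_le zero_le_one,
    ← intervalIntegral.integral_add_adjacent_intervals hf1 hf3]
  congr 1
  · exact intervalIntegral.integral_congr_Ioo_of_le h0 hf
  · rw [← intervalIntegral.integral_congr_Ioo_of_le h0 hr,
      intervalIntegral.integral_comp_sub_left (fun x => f x)]
    norm_num

lemma wittenIntegral_eq_integral {s : ℂ} (hs : 1 < s.re) :
    wittenIntegral s = ∫ x in Set.Ioo (0 : ℝ) 1,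
      hurwitzZeta (x : UnitAddCircle) (1 - s) *
        hurwitzZeta ((1 - x : ℝ) : UnitAddCircle) (1 - s) ^ 2 := by
  have hA := tameCoeff_hurwitzCoeff
  have hE := tameCoeff_hurwitzCoeffAlt
  have hs0 : s ≠ 0 := fun h => by norm_num [h] at hs
  have hb1 : 0 < s.re := by linarith
  have hb2 : 0 < (2 * s + -1).re := by simp; linarith
  have hb3 : 0 < (1 : ℂ).re := by simp
  set P : (ℕ → ℂ → ℂ) → ℂ → ℝ → ℂ :=
    fun c b x => (x : ℂ) ^ (b - 1) * ∑' k, c k s * (x : ℂ) ^ k with hP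
  have hZ : ∀ x ∈ Set.Ioo (0 : ℝ) (1 / 2), ‖(x : ℂ)‖ ≤ 1 / 2 ∧
      hurwitzZeta ((1 - x : ℝ) : UnitAddCircle) (1 - s) =
        (-s)⁻¹ * ∑' k, hurwitzCoeff k s * (x : ℂ) ^ k ∧
      hurwitzZeta (x : UnitAddCircle) (1 - s) =
        (-s)⁻¹ * (-s * (x : ℂ) ^ (s - 1) + ∑' k, hurwitzCoeffAlt k s * (x : ℂ) ^ k) ∧
      (x : ℂ) ^ (2 * s + -1 - 1) = (x : ℂ) ^ (s - 1) * (x : ℂ) ^ (s - 1) := fun x hx => by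
    refine ⟨?_, ?_, ?_, ?_⟩
    · rw [norm_real, Real.norm_of_nonneg hx.1.le]
      exact hx.2.le
    · rw [← neg_mul_hurwitzZeta_one_sub hx hs0, inv_mul_cancel_left₀ (neg_ne_zero.mpr hs0)]
    · rw [eq_inv_mul_iff_mul_eq₀ (neg_ne_zero.mpr hs0), neg_mul_hurwitzZeta hx hs0]
      rfl
    · rw [← cpow_add _ _ (by exact_mod_cast hx.1.ne')]
      ring_nf
  have i1 := ((hA.mul hA).intervalIntegrable s hb1).const_mul (-s)
  have i2 := (hE.mul (hA.mul hA)).intervalIntegrable s hb3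
  have i3 := (hA.intervalIntegrable s hb2).const_mul (s ^ 2)
  have i4 := ((hE.mul hA).intervalIntegrable s hb1).const_mul (-s * 2)
  have i5 := (hE.mul (hE.mul hA)).intervalIntegrable s hb3
  rw [integral_Ioo_eq_add_reflect
    (g := fun x => ((-s) ^ 3)⁻¹ * (-s * P (cauchyMul hurwitzCoeff hurwitzCoeff) s x +
      P (cauchyMul hurwitzCoeffAlt (cauchyMul hurwitzCoeff hurwitzCoeff)) 1 x))
    (h := fun x => ((-s) ^ 3)⁻¹ * (s ^ 2 * P hurwitzCoeff (2 * s + -1) x +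
      -s * 2 * P (cauchyMul hurwitzCoeffAlt hurwitzCoeff) s x +
      P (cauchyMul hurwitzCoeffAlt (cauchyMul hurwitzCoeffAlt hurwitzCoeff)) 1 x))
    ?_ ?_ ((i1.add i2).const_mul _) (((i3.add i4).add i5).const_mul _),
    intervalIntegral.integral_const_mul, intervalIntegral.integral_const_mul,
    intervalIntegral.integral_add i1 i2, intervalIntegral.integral_add (i3.add i4) i5,
    intervalIntegral.integral_add i3 i4, intervalIntegral.integral_const_mul,
    intervalIntegral.integral_const_mul, intervalIntegral.integral_const_mul]
  · have e1 := (hA.mul hA).integral_eq_mellinSum (β := fun s => 1 * s + 0) (s := s) (by simpa)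
    have e2 := (hE.mul (hA.mul hA)).integral_eq_mellinSum (β := fun _ => 1) (s := s) (by simp)
    have e3 := hA.integral_eq_mellinSum (β := fun s => 2 * s + -1) (s := s) hb2
    have e4 := (hE.mul hA).integral_eq_mellinSum (β := fun s => 1 * s + 0) (s := s) (by simpa)
    have e5 := (hE.mul (hE.mul hA)).integral_eq_mellinSum (β := fun _ => 1) (s := s) (by simp)
    rw [wittenIntegral, ← e1, ← e2, ← e3, ← e4, ← e5]
    simp only [one_mul, add_zero]
    ring
  · intro x hx
    obtain ⟨hx', h1, h2, h3⟩ := hZ x hx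
    simp only [hP, h1, h2, ← hA.tsum_mul_tsum hA s hx', ← hE.tsum_mul_tsum (hA.mul hA) s hx',
      sub_self, cpow_zero]
    field_simp
  · intro x hx
    obtain ⟨hx', h1, h2, h3⟩ := hZ x hx
    simp only [sub_sub_cancel, hP, h1, h2, h3, ← hE.tsum_mul_tsum hA s hx',
      ← hE.tsum_mul_tsum (hE.mul hA) s hx', sub_self, cpow_zero]
    field_simp
    ring

lemma hurwitzCoeff_mul_neg_natCast {m j : ℕ} (hm : 0 < m) (hj : j ≤ m) :
    hurwitzCoeff j (-(m : ℂ)) * hurwitzCoeff (m - j) (-(m : ℂ)) =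
      (m : ℂ) ^ 2 * ((Nat.choose (m + j) j : ℂ) * (Nat.choose (2 * m - j) (m - j) : ℂ) *
        riemannZeta ((1 + m + j : ℕ) : ℂ) * riemannZeta ((1 + 2 * m - j : ℕ) : ℂ)) := by
  rw [hurwitzCoeff_neg_natCast hm, hurwitzCoeff_neg_natCast hm,
    show m + (m - j) = 2 * m - j by omega, show 1 + m + (m - j) = 1 + 2 * m - j by omega]
  ring

lemma tendsto_add_mul_wittenIntegral {m : ℕ} (hm : 0 < m) :
    Tendsto (fun s => (s + (m : ℂ)) * wittenIntegral s) (nhdsWithin (-(m : ℂ)) {-(m : ℂ)}ᶜ)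
      (nhds ((∑ j ∈ Finset.range (m + 1),
          (Nat.choose (m + j) j : ℂ) * (Nat.choose (2 * m - j) (m - j) : ℂ) *
            riemannZeta ((1 + m + j : ℕ) : ℂ) * riemannZeta ((1 + 2 * m - j : ℕ) : ℂ) *
            (1 + 2 * (-1 : ℂ) ^ j)) +
        (1 / 2) * (Nat.choose (3 * m + 1) (2 * m + 1) : ℂ) *
          riemannZeta ((3 * m + 2 : ℕ) : ℂ))) := by
  have hA := tameCoeff_hurwitzCoeff
  have hE := tameCoeff_hurwitzCoeffAlt
  have hm0 : (m : ℂ) ≠ 0 := by exact_mod_cast hm.ne'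
  have hne : ∀ k : ℕ, (1 : ℂ) + k ≠ 0 := fun k => by
    exact_mod_cast (Nat.succ_ne_zero k) ∘ fun h => by omega
  have t1 := (hA.mul hA).tendsto_sub_mul_mellinSum_affine (p := 1) (q := 0) (z := -(m : ℂ))
    (k₀ := m) one_ne_zero (by ring)
  have t2 := (hE.mul hA).tendsto_sub_mul_mellinSum_affine (p := 1) (q := 0) (z := -(m : ℂ))
    (k₀ := m) one_ne_zero (by ring)
  have t3 := hA.tendsto_sub_mul_mellinSum_affine (p := 2) (q := -1) (z := -(m : ℂ))
    (k₀ := 2 * m + 1) two_ne_zero (by push_cast; ring)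
  have t4 := (hE.mul (hA.mul hA)).tendsto_sub_mul_mellinSum_zero (β := fun _ => 1)
    (z := -(m : ℂ)) (by fun_prop) hne
  have t5 := (hE.mul (hE.mul hA)).tendsto_sub_mul_mellinSum_zero (β := fun _ => 1)
    (z := -(m : ℂ)) (by fun_prop) hne
  have tid : Tendsto (fun s : ℂ => s) (nhdsWithin (-(m : ℂ)) {-(m : ℂ)}ᶜ) (nhds (-(m : ℂ))) :=
    nhdsWithin_le_nhds
  have hsum : cauchyMul hurwitzCoeff hurwitzCoeff m (-(m : ℂ)) +
      2 * cauchyMul hurwitzCoeffAlt hurwitzCoeff m (-(m : ℂ)) = (m : ℂ) ^ 2 *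
      ∑ j ∈ Finset.range (m + 1), (Nat.choose (m + j) j : ℂ) *
        (Nat.choose (2 * m - j) (m - j) : ℂ) * riemannZeta ((1 + m + j : ℕ) : ℂ) *
        riemannZeta ((1 + 2 * m - j : ℕ) : ℂ) * (1 + 2 * (-1 : ℂ) ^ j) := by
    rw [cauchyMul, cauchyMul, Finset.mul_sum, Finset.mul_sum, ← Finset.sum_add_distrib]
    refine Finset.sum_congr rfl fun j hj => ?_
    have h := hurwitzCoeff_mul_neg_natCast hm (Nat.lt_succ_iff.mp (Finset.mem_range.mp hj))
    rw [hurwitzCoeffAlt]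
    linear_combination (1 + 2 * (-1 : ℂ) ^ j) * h
  have t := ((tid.neg.pow 3).inv₀ (by simpa using hm0)).mul (((tid.neg.mul (t1.add
    (t2.const_mul 2))).add ((tid.pow 2).mul t3)).add (t4.add t5))
  convert t using 1
  · ext s
    rw [wittenIntegral]
    ring
  · congr 1
    rw [div_one, div_one, hsum, hurwitzCoeff_neg_natCast hm,
      show m + (2 * m + 1) = 3 * m + 1 by ring, show 1 + m + (2 * m + 1) = 3 * m + 2 by ring,
      neg_neg]
    field_simp
    ring

/-- The meromorphic continuation of `I_{A₂}(s) = ∫_0^1 ζ(1-s,x)ζ(1-s,1-x)² dx`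
has, at every negative integer `-m`, residue
`Σ_{j=0}^m C(m+j,j) C(2m-j,m-j) ζ(1+m+j) ζ(1+2m-j) (1+2(-1)^j) + (1/2) C(3m+1,2m+1) ζ(3m+2)`. -/
theorem stmt_8 :
    ∃ F : ℂ → ℂ,
      (∀ z : ℂ, MeromorphicAt F z) ∧
      (∀ s : ℂ, 1 < s.re →
        F s = ∫ x in Set.Ioo (0 : ℝ) 1,
          hurwitzZeta (x : UnitAddCircle) (1 - s) *
            hurwitzZeta ((1 - x : ℝ) : UnitAddCircle) (1 - s) ^ 2) ∧
      (∀ m : ℕ, 0 < m →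
        Tendsto (fun s => (s + (m : ℂ)) * F s) (nhdsWithin (-(m : ℂ)) {-(m : ℂ)}ᶜ)
          (nhds ((∑ j ∈ Finset.range (m + 1),
              (Nat.choose (m + j) j : ℂ) * (Nat.choose (2 * m - j) (m - j) : ℂ) *
                riemannZeta ((1 + m + j : ℕ) : ℂ) * riemannZeta ((1 + 2 * m - j : ℕ) : ℂ) *
                (1 + 2 * (-1 : ℂ) ^ j)) +
            (1 / 2) * (Nat.choose (3 * m + 1) (2 * m + 1) : ℂ) *
              riemannZeta ((3 * m + 2 : ℕ) : ℂ)))) := by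
  exact ⟨wittenIntegral, meromorphicAt_wittenIntegral, fun _ => wittenIntegral_eq_integral,
    fun _ => tendsto_add_mul_wittenIntegral⟩
end

section
/- For every positive integer k there exists a rational number q such that Σ_{m,n ≥ 1} 1/(m·n·(m+n))^{2k} = q · π^{6k}, the sum ranging over all pairs of positive integers (m,n). -/
theorem HasSum.mul_self_of_summable_norm {ι : Type*} {f : ι → ℂ} {a : ℂ} (h : HasSum f a)
    (hf : Summable fun i => ‖f i‖) : HasSum (fun p : ι × ι => f p.1 * f p.2) (a * a) :=
  HasSum.mul h h (summable_mul_of_summable_norm hf hf)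

open Complex in
/-- The absolutely convergent triple convolution attached to the Fourier series of `B_K`. -/
theorem hasSum_int_witten_su3 {K : ℕ} (hK : 2 ≤ K) (heven : Even K) :
    HasSum (fun p : ℤ × ℤ => 1 / ((p.1 : ℂ) * p.2 * (p.1 + p.2)) ^ K)
      ((-(2 * Real.pi * I) ^ K / (K.factorial : ℂ)) ^ 3 *
        ((∫ x in (0 : ℝ)..1, bernoulliFun K x ^ 3 : ℝ) : ℂ)) := by
  have hK0 : K ≠ 0 := by lia
  set c : ℂ := -(2 * Real.pi * I) ^ K / (K.factorial : ℂ) with hc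
  have hc0 : c ≠ 0 :=
    div_ne_zero (neg_ne_zero.mpr (pow_ne_zero _ two_pi_I_ne_zero))
      (Nat.cast_ne_zero.mpr K.factorial_ne_zero)
  have hsum : Summable fun n : ℤ => ‖1 / (n : ℂ) ^ K‖ := by
    have : (fun n : ℤ => ‖1 / (n : ℂ) ^ K‖) = fun n : ℤ => |1 / (n : ℝ) ^ K| := by
      ext n
      simp only [one_div, norm_inv, norm_pow, norm_intCast, pow_abs, abs_inv]
    rw [this, summable_abs_iff, Real.summable_one_div_int_pow]
    lia
  have hB : Continuous (bernoulliFun K) := Polynomial.continuous _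
  have hnorm (n : ℤ) (x : UnitAddCircle) : ‖fourier n x‖ = 1 := by
    rw [fourier_apply]; exact Circle.norm_coe _
  have hint : HasSum
      (fun p : ℤ × ℤ => ∫ x in (0 : ℝ)..1,
        (1 / (p.1 : ℂ) ^ K) * (1 / (p.2 : ℂ) ^ K) *
          (fourier (p.1 + p.2) (x : UnitAddCircle) * (bernoulliFun K x : ℂ)))
      (∫ x in (0 : ℝ)..1, c ^ 2 * (bernoulliFun K x : ℂ) ^ 3) := by
    refine intervalIntegral.hasSum_integral_of_dominated_convergence
      (fun p x => ‖1 / (p.1 : ℂ) ^ K‖ * ‖1 / (p.2 : ℂ) ^ K‖ * |bernoulliFun K x|) ?_ ?_ ?_ ?_ ?_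
    · intro p
      refine Continuous.aestronglyMeasurable ?_
      have : Continuous fun x : ℝ => fourier (p.1 + p.2) (x : UnitAddCircle) :=
        (ContinuousMap.continuous _).comp (AddCircle.continuous_mk' 1)
      fun_prop
    · refine fun p => Filter.Eventually.of_forall fun x _ => ?_
      rw [norm_mul, norm_mul, norm_mul, hnorm, one_mul, norm_real, Real.norm_eq_abs]
    · refine Filter.Eventually.of_forall fun x _ => ?_
      exact (hsum.mul_of_nonneg hsum (fun _ => norm_nonneg _) fun _ => norm_nonneg _).mul_right _
    · simp_rw [tsum_mul_right]
      exact (continuous_const.mul hB.abs).intervalIntegrable _ _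
    · refine Filter.Eventually.of_forall fun x hx => ?_
      rw [Set.uIoc_of_le zero_le_one] at hx
      have h := hasSum_one_div_pow_mul_fourier_mul_bernoulliFun hK (Set.Ioc_subset_Icc_self hx)
      have hs : Summable fun n : ℤ => ‖1 / (n : ℂ) ^ K * fourier n (x : UnitAddCircle)‖ := by
        simpa only [norm_mul, hnorm, mul_one] using hsum
      rw [← hc] at h
      have hprod := h.mul_self_of_summable_norm hs
      have hcube : c ^ 2 * (bernoulliFun K x : ℂ) ^ 3 =
          c * bernoulliFun K x * (c * bernoulliFun K x) * bernoulliFun K x := by ring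
      rw [hcube]
      refine (hprod.mul_right (bernoulliFun K x : ℂ)).congr_fun fun p => ?_
      rw [fourier_add]
      ring
  have hcoeff (n : ℤ) : ∫ x in (0 : ℝ)..1,
      fourier n (x : UnitAddCircle) * (bernoulliFun K x : ℂ) = c⁻¹ * (1 / (n : ℂ) ^ K) := by
    have h := bernoulliFourierCoeff_eq hK0 (-n)
    rw [bernoulliFourierCoeff, fourierCoeffOn_eq_integral] at h
    simp only [fourier_coe_apply, sub_zero, div_one, one_smul, neg_neg, smul_eq_mul] at h
    simp only [fourier_coe_apply]
    rw [h, hc, Int.cast_neg, mul_neg, heven.neg_pow, mul_pow _ (n : ℂ)]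
    simp only [div_eq_mul_inv, mul_inv, inv_inv, inv_neg]
    ring
  have hvalue : c ^ 3 * ((∫ x in (0 : ℝ)..1, bernoulliFun K x ^ 3 : ℝ) : ℂ) =
      c * ∫ x in (0 : ℝ)..1, c ^ 2 * (bernoulliFun K x : ℂ) ^ 3 := by
    rw [intervalIntegral.integral_const_mul, ← intervalIntegral.integral_ofReal]
    push_cast
    ring
  rw [hvalue]
  refine (hint.mul_left c).congr_fun fun p => ?_
  rw [intervalIntegral.integral_const_mul, hcoeff]
  push_cast
  simp only [mul_pow, one_div, mul_inv]
  field_simp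

/-- Rational polynomials have rational integrals over the unit interval. -/
theorem Polynomial.exists_rat_integral_unitInterval (P : Polynomial ℚ) :
    ∃ q : ℚ, ∫ x in (0 : ℝ)..1, (P.map (algebraMap ℚ ℝ)).eval x = q := by
  induction P using Polynomial.induction_on' with
  | add P Q hP hQ =>
    obtain ⟨p, hp⟩ := hP
    obtain ⟨q, hq⟩ := hQ
    refine ⟨p + q, ?_⟩
    simp only [Polynomial.map_add, Polynomial.eval_add]
    rw [intervalIntegral.integral_add ((Polynomial.continuous _).intervalIntegrable _ _)
      ((Polynomial.continuous _).intervalIntegrable _ _), hp, hq]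
    push_cast
    rfl
  | monomial n a =>
    exact ⟨a / (n + 1), by simp [div_eq_mul_inv]⟩

/-- The six integral-linear parametrisations of the open Weyl chambers of the root system `A₂`. -/
def chamberPoint (i : Fin 6) (p : ℕ+ × ℕ+) : ℤ × ℤ :=
  match i with
  | 0 => ((p.1 : ℕ), (p.2 : ℕ))
  | 1 => (-(p.1 : ℕ), -(p.2 : ℕ))
  | 2 => ((p.1 : ℕ) + (p.2 : ℕ), -(p.2 : ℕ))
  | 3 => (-((p.1 : ℕ) + (p.2 : ℕ)), (p.2 : ℕ))
  | 4 => (-(p.1 : ℕ), (p.1 : ℕ) + (p.2 : ℕ))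
  | 5 => ((p.1 : ℕ), -((p.1 : ℕ) + (p.2 : ℕ)))

theorem chamberPoint_injective :
    Function.Injective fun s : Fin 6 × (ℕ+ × ℕ+) => chamberPoint s.1 s.2 := by
  rintro ⟨i, a, b⟩ ⟨j, c, d⟩ h
  have ha := a.pos
  have hb := b.pos
  have hc := c.pos
  have hd := d.pos
  simp only [Prod.mk.injEq, ← PNat.coe_inj]
  fin_cases i <;> fin_cases j <;>
    simp only [chamberPoint, Prod.mk.injEq] at h <;>
    first
    | (exfalso; omega)
    | exact ⟨rfl, by omega, by omega⟩

theorem exists_chamberPoint_eq {m n : ℤ} (hm : m ≠ 0) (hn : n ≠ 0) (hmn : m + n ≠ 0) :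
    ∃ s : Fin 6 × (ℕ+ × ℕ+), chamberPoint s.1 s.2 = (m, n) := by
  have lift (a : ℤ) (ha : 0 < a) : ∃ b : ℕ+, ((b : ℕ) : ℤ) = a :=
    ⟨⟨a.toNat, by omega⟩, Int.toNat_of_nonneg ha.le⟩
  have key (i : Fin 6) (a b : ℤ) (ha : 0 < a) (hb : 0 < b)
      (h : ∀ p : ℕ+ × ℕ+, ((p.1 : ℕ) : ℤ) = a → ((p.2 : ℕ) : ℤ) = b →
        chamberPoint i p = (m, n)) : ∃ s : Fin 6 × (ℕ+ × ℕ+), chamberPoint s.1 s.2 = (m, n) := by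
    obtain ⟨p, hp⟩ := lift a ha
    obtain ⟨q, hq⟩ := lift b hb
    exact ⟨(i, p, q), h _ hp hq⟩
  rcases lt_or_gt_of_ne hm with hm | hm <;> rcases lt_or_gt_of_ne hn with hn | hn
  · refine key 1 (-m) (-n) (by lia) (by lia) fun p h1 h2 => ?_
    simp only [chamberPoint, Prod.mk.injEq]; lia
  · rcases lt_or_gt_of_ne hmn with hmn | hmn
    · refine key 3 (-(m + n)) n (by lia) (by lia) fun p h1 h2 => ?_
      simp only [chamberPoint, Prod.mk.injEq]; lia
    · refine key 4 (-m) (m + n) (by lia) (by lia) fun p h1 h2 => ?_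
      simp only [chamberPoint, Prod.mk.injEq]; lia
  · rcases lt_or_gt_of_ne hmn with hmn | hmn
    · refine key 5 m (-(m + n)) (by lia) (by lia) fun p h1 h2 => ?_
      simp only [chamberPoint, Prod.mk.injEq]; lia
    · refine key 2 (m + n) (-n) (by lia) (by lia) fun p h1 h2 => ?_
      simp only [chamberPoint, Prod.mk.injEq]; lia
  · refine key 0 m n (by lia) (by lia) fun p h1 h2 => ?_
    simp only [chamberPoint, Prod.mk.injEq]; lia

/-- The sum over all of `ℤ × ℤ` is six times the sum over the dominant chamber. -/
theorem six_mul_tsum_witten_su3 {K : ℕ} (hK0 : K ≠ 0) (heven : Even K) {S : ℝ}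
    (h : HasSum (fun p : ℤ × ℤ => 1 / ((p.1 : ℝ) * p.2 * (p.1 + p.2)) ^ K) S) :
    6 * ∑' p : ℕ+ × ℕ+, (1 : ℝ) / (((p.1 : ℕ) : ℝ) * ((p.2 : ℕ) : ℝ) *
        (((p.1 : ℕ) : ℝ) + ((p.2 : ℕ) : ℝ))) ^ K = S := by
  rw [← chamberPoint_injective.hasSum_iff] at h
  · have hterm (s : Fin 6 × (ℕ+ × ℕ+)) :
        ((fun p : ℤ × ℤ => 1 / ((p.1 : ℝ) * p.2 * (p.1 + p.2)) ^ K) ∘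
          fun s : Fin 6 × (ℕ+ × ℕ+) => chamberPoint s.1 s.2) s =
        (1 : ℝ) / (((s.2.1 : ℕ) : ℝ) * ((s.2.2 : ℕ) : ℝ) *
          (((s.2.1 : ℕ) : ℝ) + ((s.2.2 : ℕ) : ℝ))) ^ K := by
      obtain ⟨i, p⟩ := s
      rw [Function.comp_apply]
      congr 1
      rw [← heven.pow_abs, ← heven.pow_abs (_ * _)]
      congr 1
      rw [abs_eq_abs]
      fin_cases i <;> simp only [chamberPoint] <;> push_cast <;>
        first
        | (left; ring1)
        | (right; ring1)
    simp_rw [funext hterm] at h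
    rw [← h.tsum_eq, h.summable.tsum_prod, tsum_fintype (β := Fin 6)]
    simp
  · rintro ⟨m, n⟩ hmem
    by_contra hne
    refine hmem (exists_chamberPoint_eq ?_ ?_ ?_)
    · rintro rfl; simp [hK0] at hne
    · rintro rfl; simp [hK0] at hne
    · intro hmn
      have : (m : ℝ) + n = 0 := mod_cast hmn
      simp [this, hK0] at hne


/-- Witten–Zagier rationality for `SU(3)`: for every positive integer `k`,
`Σ_{m,n≥1} (mn(m+n))^{-2k}` is a rational multiple of `π^{6k}`. -/
theorem stmt_10 (k : ℕ) (hk : 0 < k) :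
    ∃ q : ℚ,
      ∑' p : ℕ+ × ℕ+, (1 : ℝ) / (((p.1 : ℕ) : ℝ) * ((p.2 : ℕ) : ℝ) *
        (((p.1 : ℕ) : ℝ) + ((p.2 : ℕ) : ℝ))) ^ (2 * k) =
      (q : ℝ) * Real.pi ^ (6 * k) := by
  obtain ⟨r, hr⟩ := Polynomial.exists_rat_integral_unitInterval (Polynomial.bernoulli (2 * k) ^ 3)
  simp only [Polynomial.map_pow, Polynomial.eval_pow] at hr
  have h := hasSum_int_witten_su3 (K := 2 * k) (by lia) (even_two_mul k)
  have hint : ∫ x in (0 : ℝ)..1, bernoulliFun (2 * k) x ^ 3 = r := hr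
  have hconst : (-(2 * Real.pi * Complex.I) ^ (2 * k) / ((2 * k).factorial : ℂ)) ^ 3 * ((r : ℝ) : ℂ)
      = (((-(-4) ^ k / ((2 * k).factorial : ℚ)) ^ 3 * r : ℚ) * Real.pi ^ (6 * k) : ℝ) := by
    have : (2 * Real.pi * Complex.I) ^ (2 * k) = (-4) ^ k * (Real.pi : ℂ) ^ (2 * k) := by
      rw [pow_mul, pow_mul, ← mul_pow, mul_pow, Complex.I_sq]
      ring
    rw [this]
    push_cast
    ring
  rw [hint, hconst] at h
  have hreal : HasSum (fun p : ℤ × ℤ => 1 / ((p.1 : ℝ) * p.2 * (p.1 + p.2)) ^ (2 * k))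
      (((-(-4) ^ k / ((2 * k).factorial : ℚ)) ^ 3 * r : ℚ) * Real.pi ^ (6 * k)) := by
    rw [← Complex.hasSum_ofReal]
    convert h using 2
    push_cast
    rfl
  have h6 := six_mul_tsum_witten_su3 (by lia) (even_two_mul k) hreal
  refine ⟨(-(-4) ^ k / ((2 * k).factorial : ℚ)) ^ 3 * r / 6, ?_⟩
  rw [Rat.cast_div]
  push_cast at h6 ⊢
  linarith
end
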